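/- arXiv:2104.14371 — 4 statements merged into one kernel-verified Lean document; each statement's English description precedes it below -/
import Mathlib

section
/- Let B ⊆ ℝ^p be convex, let R, R_n : ℝ^p → ℝ with R_n convex on B, and let β₀ ∈ B minimize R over B. Let Ω be a norm on ℝ^p that is weakly decomposable for a set S₀ ⊆ {1,…,p} with associated norm Ω^{S₀^c}, and let Ω̲(β) := Ω(β_{S₀}) + Ω^{S₀^c}(β_{S₀^c}). Let X be an n×p real matrix and let λ > 0, λ_e > 0, t₁ ≥ 0, C_ρ > 0, Γ > 0 be constants; set M := 18·λ·C_ρ²·Γ² + 32·Ω((β₀)_{S₀^c}). Assume: (E1) for every β̃ ∈ B with Ω̲(β̃ − β₀) ≤ M, R(β̃) − R(β₀) ≥ ‖X(β̃ − β₀)‖_n²/(2C_ρ²) − M²t₁/(2C_ρ²); (E3) for every β' ∈ B with Ω̲(β' − β₀) ≤ M, |(R_n(β') − R(β')) − (R_n(β₀) − R(β₀))| ≤ λ_e·M; (E2) there is Γ̂ ≥ 0 with Γ̂² ≤ 2Γ² such that every v ∈ ℝ^p with Ω^{S₀^c}(v_{S₀^c}) ≤ 2·Ω(v_{S₀}) satisfies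 Ω(v_{S₀}) ≤ Γ̂·‖Xv‖_n; and λ ≥ 16·λ_e and λ_e ≥ M·t₁/(2C_ρ²). Then every minimizer β̂ of β ↦ R_n(β) + λ·Ω(β) over B satisfies Ω̲(β̂ − β₀) ≤ 18·λ·C_ρ²·Γ² + 32·Ω((β₀)_{S₀^c}). -/
open scoped BigOperators

/-- `N` is a norm on `ℝ^p`. -/
def IsNorm {p : ℕ} (N : (Fin p → ℝ) → ℝ) : Prop :=
  (∀ x, 0 ≤ N x) ∧ (∀ x, N x = 0 ↔ x = 0) ∧
  (∀ (c : ℝ) (x : Fin p → ℝ), N (c • x) = |c| * N x) ∧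
  (∀ x y, N (x + y) ≤ N x + N y)

/-- `N` is a norm on the vectors of `ℝ^p` supported on `Sᶜ` (a seminorm on `ℝ^p`
which is definite on vectors vanishing on `S`). -/
def IsNormOnCompl {p : ℕ} (S : Finset (Fin p)) (N : (Fin p → ℝ) → ℝ) : Prop :=
  (∀ x, 0 ≤ N x) ∧
  (∀ (c : ℝ) (x : Fin p → ℝ), N (c • x) = |c| * N x) ∧
  (∀ x y, N (x + y) ≤ N x + N y) ∧
  (∀ x : Fin p → ℝ, (∀ i ∈ S, x i = 0) → (N x = 0 ↔ x = 0))

/-- `restr S β` is the vector `β_S`: coordinates outside `S` are set to zero. -/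
def restr {p : ℕ} (S : Finset (Fin p)) (β : Fin p → ℝ) : Fin p → ℝ :=
  fun i => if i ∈ S then β i else 0

/-- Deterministic form of Theorem 1: the oracle inequality for structured sparsity
penalized GLM estimators, conditional on the events E1, E2, E3. -/
theorem statement0
    {n p : ℕ} (hn : 0 < n)
    (B : Set (Fin p → ℝ)) (hB : Convex ℝ B)
    (R Rn : (Fin p → ℝ) → ℝ) (hRn : ConvexOn ℝ B Rn)
    (β₀ : Fin p → ℝ) (hβ₀ : β₀ ∈ B) (hβ₀min : ∀ β ∈ B, R β₀ ≤ R β)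
    (Ω ΩSc : (Fin p → ℝ) → ℝ) (S₀ : Finset (Fin p))
    (hΩ : IsNorm Ω) (hΩSc : IsNormOnCompl S₀ ΩSc)
    (hweak : ∀ β : Fin p → ℝ, Ω (restr S₀ β) + ΩSc (restr S₀ᶜ β) ≤ Ω β)
    (Ωu : (Fin p → ℝ) → ℝ)
    (hΩu : ∀ β : Fin p → ℝ, Ωu β = Ω (restr S₀ β) + ΩSc (restr S₀ᶜ β))
    (X : Matrix (Fin n) (Fin p) ℝ)
    (lam lamE t₁ Cρ Γ M : ℝ)
    (hlam : 0 < lam) (hlamE : 0 < lamE) (ht₁ : 0 ≤ t₁) (hCρ : 0 < Cρ) (hΓ : 0 < Γ)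
    (hM : M = 18 * lam * Cρ ^ 2 * Γ ^ 2 + 32 * Ω (restr S₀ᶜ β₀))
    -- (E1) sample one-point margin condition
    (hE1 : ∀ β ∈ B, Ωu (β - β₀) ≤ M →
      R β - R β₀ ≥
        (∑ i, (X.mulVec (β - β₀) i) ^ 2) / (n : ℝ) / (2 * Cρ ^ 2)
          - M ^ 2 * t₁ / (2 * Cρ ^ 2))
    -- (E3) empirical process bound
    (hE3 : ∀ β ∈ B, Ωu (β - β₀) ≤ M →
      |(Rn β - R β) - (Rn β₀ - R β₀)| ≤ lamE * M)
    -- (E2) sample effective sparsity bound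
    (hE2 : ∃ Γhat : ℝ, 0 ≤ Γhat ∧ Γhat ^ 2 ≤ 2 * Γ ^ 2 ∧
      ∀ v : Fin p → ℝ, ΩSc (restr S₀ᶜ v) ≤ 2 * Ω (restr S₀ v) →
        Ω (restr S₀ v) ≤ Γhat * Real.sqrt ((∑ i, (X.mulVec v i) ^ 2) / (n : ℝ)))
    (hlamlamE : lam ≥ 16 * lamE)
    (hlamEt : lamE ≥ M * t₁ / (2 * Cρ ^ 2))
    (βhat : Fin p → ℝ) (hβhat : βhat ∈ B)
    (hopt : ∀ β ∈ B, Rn βhat + lam * Ω βhat ≤ Rn β + lam * Ω β) :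
    Ωu (βhat - β₀) ≤ 18 * lam * Cρ ^ 2 * Γ ^ 2 + 32 * Ω (restr S₀ᶜ β₀) := by
  by_contra hcon
  rw [← hM] at hcon
  push Not at hcon
  obtain ⟨hΩ0, hΩz, hΩs, hΩa⟩ := hΩ
  obtain ⟨hS0, hSs, hSa, -⟩ := hΩSc
  have radd : ∀ (S : Finset (Fin p)) (x y : Fin p → ℝ),
      restr S (x + y) = restr S x + restr S y := by
    intro S x y; funext i; simp only [restr, Pi.add_apply]; split_ifs <;> simp
  have rsmul : ∀ (S : Finset (Fin p)) (c : ℝ) (x : Fin p → ℝ),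
      restr S (c • x) = c • restr S x := by
    intro S c x; funext i; simp only [restr, Pi.smul_apply, smul_eq_mul]; split_ifs <;> simp
  have hsplit : β₀ = restr S₀ β₀ + restr S₀ᶜ β₀ := by
    funext i; simp only [restr, Pi.add_apply, Finset.mem_compl]; split_ifs <;> simp
  have hidem : restr S₀ᶜ (restr S₀ᶜ β₀) = restr S₀ᶜ β₀ := by
    funext i; simp only [restr]; split_ifs <;> rfl
  have hw0 := hΩ0 (restr S₀ᶜ β₀)
  have hSw : ΩSc (restr S₀ᶜ β₀) ≤ Ω (restr S₀ᶜ β₀) := by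
    have h := hweak (restr S₀ᶜ β₀)
    rw [hidem] at h
    linarith [hΩ0 (restr S₀ (restr S₀ᶜ β₀))]
  have hΩβ₀ : Ω β₀ ≤ Ω (restr S₀ β₀) + Ω (restr S₀ᶜ β₀) := by
    have h := hΩa (restr S₀ β₀) (restr S₀ᶜ β₀)
    rwa [← hsplit] at h
  have hg : 0 < Cρ ^ 2 * Γ ^ 2 := by positivity
  have hMpos : 0 < M := by
    have : 0 < lam * (Cρ ^ 2 * Γ ^ 2) := by positivity
    rw [hM]; linarith
  have hD : 0 < Ωu (βhat - β₀) := hMpos.trans hcon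
  obtain ⟨s, hs⟩ : ∃ s, s = M / Ωu (βhat - β₀) := ⟨_, rfl⟩
  have hs0 : 0 < s := by rw [hs]; positivity
  have hs1 : s ≤ 1 := by rw [hs, div_le_one hD]; exact hcon.le
  obtain ⟨v, hv⟩ : ∃ v, v = s • (βhat - β₀) := ⟨_, rfl⟩
  have hvM : Ωu v = M := by
    have : Ωu v = s * Ωu (βhat - β₀) := by
      rw [hv, hΩu, hΩu, rsmul, rsmul, hΩs, hSs, abs_of_pos hs0]; ring
    rw [this, hs]; field_simp
  have hb : β₀ + v = (1 - s) • β₀ + s • βhat := by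
    rw [hv]; funext i; simp; ring
  have hbB : β₀ + v ∈ B := by
    rw [hb]; exact hB hβ₀ hβhat (by linarith) hs0.le (by ring)
  have hsub : β₀ + v - β₀ = v := by simp
  have hconv : Rn (β₀ + v) + lam * Ω (β₀ + v) ≤ Rn β₀ + lam * Ω β₀ := by
    have h1 : Rn (β₀ + v) ≤ (1 - s) * Rn β₀ + s * Rn βhat := by
      rw [hb]; exact hRn.2 hβ₀ hβhat (by linarith) hs0.le (by ring)
    have h2 : Ω (β₀ + v) ≤ (1 - s) * Ω β₀ + s * Ω βhat := by
      rw [hb]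
      refine (hΩa _ _).trans ?_
      rw [hΩs, hΩs, abs_of_pos hs0, abs_of_nonneg (by linarith : (0:ℝ) ≤ 1 - s)]
    have h3 := mul_le_mul_of_nonneg_left h2 hlam.le
    have h4 := mul_le_mul_of_nonneg_left (hopt β₀ hβ₀) hs0.le
    linarith
  have e1 := hE1 _ hbB (by rw [hsub, hvM])
  have e3 := (abs_le.1 (hE3 _ hbB (by rw [hsub, hvM]))).1
  have e0 := hβ₀min _ hbB
  rw [hsub] at e1
  have hneg : ∀ x, Ω (-x) = Ω x := by
    intro x; have := hΩs (-1) x; simpa using this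
  have hnegS : ∀ x, ΩSc (-x) = ΩSc x := by
    intro x; have := hSs (-1) x; simpa using this
  have hlow := hweak (β₀ + v)
  rw [radd, radd] at hlow
  have l1 := hΩa (restr S₀ β₀ + restr S₀ v) (-restr S₀ v)
  rw [hneg, add_neg_cancel_right] at l1
  have l2 := hSa (restr S₀ᶜ β₀ + restr S₀ᶜ v) (-restr S₀ᶜ β₀)
  rw [hnegS, add_neg_cancel_comm] at l2
  obtain ⟨Γh, hΓh0, hΓh, hE2⟩ := hE2
  have e2 := hE2 v
  rw [hΩu] at hvM
  have ha0 := hΩ0 (restr S₀ v)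
  have hx0 : 0 ≤ (∑ i, (X.mulVec v i) ^ 2) / (n : ℝ) := by positivity
  have ht : M ^ 2 * t₁ / (2 * Cρ ^ 2) ≤ M * lamE := by
    have := mul_le_mul_of_nonneg_left hlamEt hMpos.le
    calc _ = M * (M * t₁ / (2 * Cρ ^ 2)) := by ring
      _ ≤ _ := this
  generalize (∑ i, (X.mulVec v i) ^ 2) / (n : ℝ) = x at *
  generalize Ω (restr S₀ v) = a at *
  generalize ΩSc (restr S₀ᶜ v) = b at *
  generalize Ω (restr S₀ᶜ β₀) = w at *
  -- basic inequality
  have hΩdiff : lam * Ω β₀ - lam * Ω (β₀ + v) ≤ lam * (a - b + 2 * w) := by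
    rw [← mul_sub]
    exact mul_le_mul_of_nonneg_left (by linarith) hlam.le
  have basic : R (β₀ + v) - R β₀ ≤ lamE * M + lam * (a - b + 2 * w) := by linarith
  have hlM : lamE * M ≤ lam * M / 16 := by
    have := mul_le_mul_of_nonneg_right hlamlamE hMpos.le
    linarith
  obtain ⟨g, hgd⟩ : ∃ g, g = Cρ ^ 2 * Γ ^ 2 := ⟨_, rfl⟩
  rw [← hgd] at hg
  have hMg : M = 18 * lam * g + 32 * w := by rw [hM, hgd]; ring
  have hlg : 0 < lam * g := by positivity
  by_cases hc : b ≤ 2 * a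
  · have e2 := e2 hc
    have hax : a ^ 2 ≤ 2 * Γ ^ 2 * x := by
      calc a ^ 2 ≤ (Γh * Real.sqrt x) ^ 2 := pow_le_pow_left₀ ha0 e2 2
        _ = Γh ^ 2 * x := by rw [mul_pow, Real.sq_sqrt hx0]
        _ ≤ _ := mul_le_mul_of_nonneg_right hΓh hx0
    obtain ⟨q, hq⟩ : ∃ q, q = x / (2 * Cρ ^ 2) := ⟨_, rfl⟩
    have hq0 : 0 ≤ q := by rw [hq]; positivity
    have haq : a ^ 2 ≤ 4 * g * q := by
      refine hax.trans (le_of_eq ?_)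
      rw [hq, hgd]; field_simp; ring
    rw [← hq] at e1
    have key : 2 * lam * a ≤ q + 4 * lam ^ 2 * g := by
      refine abs_le_of_sq_le_sq' ?_ (by positivity) |>.2
      have := mul_le_mul_of_nonneg_left haq (by positivity : 0 ≤ 4 * lam ^ 2)
      linarith [sq_nonneg (q - 4 * lam ^ 2 * g)]
    have : lam * (13 / 16 * M) ≤ lam * (23 / 8 * (lam * g)) := by
      have hb' : b = M - a := by linarith
      have hw' : w = (M - 18 * lam * g) / 32 := by linarith
      rw [hb', hw'] at basic
      clear hE1 hE3 hE2 hopt hweak hβ₀min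
      linarith
    have := le_of_mul_le_mul_left this hlam
    linarith
  · push Not at hc
    have : 0 ≤ lam * (M / 16 + (a - b + 2 * w)) := by linarith
    have := nonneg_of_mul_nonneg_right this hlam
    linarith
end

section
/- Let Ω be a norm on ℝ^p, let S ⊆ {1,…,p}, let Ω^{S^c} be a norm on the vectors supported on S^c, and set Ω̲(β) := Ω(β_S) + Ω^{S^c}(β_{S^c}); assume ‖β‖₁ ≤ Ω̲(β) for all β ∈ ℝ^p. Let Σ̂, Σ be p×p real matrices with ‖Σ̂ − Σ‖_∞ ≤ t₁ and let L > 0. Then every β ∈ ℝ^p satisfying the cone condition Ω^{S^c}(β_{S^c}) ≤ L·Ω(β_S) satisfies β'Σ̂β ≥ β'Σβ − (L+1)²·Ω(β_S)²·t₁; in particular, if Ω(β_S) > 0 then β'Σ̂β/Ω(β_S)² ≥ β'Σβ/Ω(β_S)² − (L+1)²·t₁. -/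
open scoped BigOperators

/-- The entrywise sup-norm `‖M‖_∞` of a matrix: maximal absolute entry. -/
noncomputable def matSup {n m : ℕ} (M : Matrix (Fin n) (Fin m) ℝ) : ℝ :=
  ⨆ i, ⨆ j, |M i j|

/-- Deterministic core of Lemma A.3: transfer of the effective sparsity
quadratic form from population to sample over the cone. -/
theorem statement2 {p : ℕ}
    (Ω ΩSc : (Fin p → ℝ) → ℝ) (S : Finset (Fin p))
    (hΩ : IsNorm Ω) (hΩSc : IsNormOnCompl S ΩSc)
    (hl1 : ∀ β : Fin p → ℝ, ∑ i, |β i| ≤ Ω (restr S β) + ΩSc (restr Sᶜ β))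
    (Shat A : Matrix (Fin p) (Fin p) ℝ) (t₁ L : ℝ) (hL : 0 < L)
    (hent : matSup (Shat - A) ≤ t₁)
    (β : Fin p → ℝ) (hcone : ΩSc (restr Sᶜ β) ≤ L * Ω (restr S β)) :
    (∑ i, β i * (Shat.mulVec β) i ≥
      ∑ i, β i * (A.mulVec β) i - (L + 1) ^ 2 * (Ω (restr S β)) ^ 2 * t₁) ∧
    (0 < Ω (restr S β) →
      (∑ i, β i * (Shat.mulVec β) i) / (Ω (restr S β)) ^ 2 ≥
        (∑ i, β i * (A.mulVec β) i) / (Ω (restr S β)) ^ 2 - (L + 1) ^ 2 * t₁) := by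
  have hM0 : 0 ≤ matSup (Shat - A) :=
    Real.iSup_nonneg fun i => Real.iSup_nonneg fun j => abs_nonneg _
  have ht : 0 ≤ t₁ := hM0.trans hent
  have hij : ∀ i j, |A i j - Shat i j| ≤ t₁ := by
    intro i j
    have h1 : |(Shat - A) i j| ≤ ⨆ j, |(Shat - A) i j| :=
      le_ciSup (f := fun j => |(Shat - A) i j|) (Set.finite_range _).bddAbove j
    have h2 : (⨆ j, |(Shat - A) i j|) ≤ matSup (Shat - A) :=
      le_ciSup (f := fun i => ⨆ j, |(Shat - A) i j|) (Set.finite_range _).bddAbove i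
    rw [abs_sub_comm]
    exact (h1.trans h2).trans hent
  have hdiff : ∑ i, β i * (A.mulVec β) i - ∑ i, β i * (Shat.mulVec β) i
      ≤ (∑ i, |β i|) ^ 2 * t₁ := by
    rw [← Finset.sum_sub_distrib, sq, Finset.sum_mul_sum, Finset.sum_mul]
    refine Finset.sum_le_sum fun i _ => ?_
    simp only [Matrix.mulVec, dotProduct]
    rw [← mul_sub, ← Finset.sum_sub_distrib, Finset.mul_sum, Finset.sum_mul]
    refine Finset.sum_le_sum fun j _ => ?_
    calc β i * (A i j * β j - Shat i j * β j)
        = (β i * β j) * (A i j - Shat i j) := by ring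
      _ ≤ |(β i * β j) * (A i j - Shat i j)| := le_abs_self _
      _ = |β i| * |β j| * |A i j - Shat i j| := by rw [abs_mul, abs_mul]
      _ ≤ |β i| * |β j| * t₁ := by gcongr; exact hij i j
  have hb : ∑ i, |β i| ≤ (L + 1) * Ω (restr S β) := by
    have := hl1 β
    linarith
  have hsq : (∑ i, |β i|) ^ 2 * t₁ ≤ (L + 1) ^ 2 * (Ω (restr S β)) ^ 2 * t₁ := by
    rw [← mul_pow]
    have h0 : 0 ≤ ∑ i, |β i| := Finset.sum_nonneg fun i _ => abs_nonneg _
    gcongr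
  have main : ∑ i, β i * (Shat.mulVec β) i ≥
      ∑ i, β i * (A.mulVec β) i - (L + 1) ^ 2 * (Ω (restr S β)) ^ 2 * t₁ := by
    linarith
  refine ⟨main, fun hpos => ?_⟩
  have hp2 : 0 < (Ω (restr S β)) ^ 2 := by positivity
  rw [ge_iff_le, sub_le_iff_le_add, div_le_iff₀ hp2, add_mul, div_mul_cancel₀ _ hp2.ne']
  linarith
end

section
/- Let Ω be a norm on ℝ^p that is weakly decomposable for S ⊆ {1,…,p} with associated norm Ω^{S^c}. Then for all β, β' ∈ ℝ^p: Ω(β') − Ω(β) ≤ Ω(β_S − β'_S) − Ω^{S^c}(β_{S^c} − β'_{S^c}) + 2·Ω(β'_{S^c}). -/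
open scoped BigOperators

/-- Corollary 7.1 of van de Geer (2016): for a norm `Ω` weakly decomposable for `S`,
`Ω(β') − Ω(β) ≤ Ω(β_S − β'_S) − Ω^{Sᶜ}(β_{Sᶜ} − β'_{Sᶜ}) + 2 Ω(β'_{Sᶜ})`. -/
theorem statement5 {p : ℕ}
    (Ω ΩSc : (Fin p → ℝ) → ℝ) (S : Finset (Fin p))
    (hΩ : IsNorm Ω) (hΩSc : IsNormOnCompl S ΩSc)
    (hweak : ∀ β : Fin p → ℝ, Ω (restr S β) + ΩSc (restr Sᶜ β) ≤ Ω β)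
    (β β' : Fin p → ℝ) :
    Ω β' - Ω β ≤
      Ω (restr S β - restr S β') - ΩSc (restr Sᶜ β - restr Sᶜ β')
        + 2 * Ω (restr Sᶜ β') := by
  obtain ⟨hn, h0, hs, ht⟩ := hΩ
  obtain ⟨-, ks, kt, -⟩ := hΩSc
  have e1 : restr S β' + restr Sᶜ β' = β' := by
    funext i
    by_cases h : i ∈ S <;> simp [restr, h]
  have e2 : restr Sᶜ (restr Sᶜ β') = restr Sᶜ β' := by
    funext i
    by_cases h : i ∈ S <;> simp [restr, h]
  have a1 := ht (restr S β') (restr Sᶜ β')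
  rw [e1] at a1
  have a2 := hweak β
  have a3 := hweak (restr Sᶜ β')
  rw [e2] at a3
  have a4 := hn (restr S (restr Sᶜ β'))
  have a5 := ht (restr S β) ((-1 : ℝ) • (restr S β - restr S β'))
  rw [hs, show restr S β + (-1 : ℝ) • (restr S β - restr S β') = restr S β' by
    funext i; simp] at a5
  have a6 := kt (restr Sᶜ β) ((-1 : ℝ) • restr Sᶜ β')
  rw [ks, show restr Sᶜ β + (-1 : ℝ) • restr Sᶜ β' = restr Sᶜ β - restr Sᶜ β' by
    funext i; simp [sub_eq_add_neg]] at a6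
  simp only [abs_neg, abs_one, one_mul] at a5 a6
  linarith
end

section
/- Let X̂ be an n×p real matrix with columns X̂₁,…,X̂_p, set Σ̂ := X̂'X̂/n, fix j ∈ {1,…,p}, let V := {γ ∈ ℝ^p : γ_j = 0}, let Ω̲ be a norm on ℝ^p, let λ_nw > 0, and let γ̂ ∈ V minimize γ ↦ ‖X̂_j − X̂γ‖²/n + 2λ_nw·Ω̲(γ) over V. Set τ̂² := X̂_j'(X̂_j − X̂γ̂)/n, assume τ̂² > 0, and define Θ̂_j := (e_j − γ̂)/τ̂², where e_j is the j-th standard basis vector. Then the j-th coordinate of Σ̂Θ̂_j equals 1, and for every v ∈ V, |v'(Σ̂Θ̂_j − e_j)| ≤ (λ_nw/τ̂²)·Ω̲(v). -/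
open scoped BigOperators
open Matrix

/-- Equations (that1) and (that3): the nodewise regression output `Θ̂_j` is an
approximate inverse of the sample second-moment matrix `Σ̂` in the dual norm of `Ω̲`. -/
theorem statement10 {n p : ℕ} (hn : 0 < n)
    (Xh : Matrix (Fin n) (Fin p) ℝ) (j : Fin p)
    (Shat : Matrix (Fin p) (Fin p) ℝ) (hShat : Shat = (n : ℝ)⁻¹ • (Xhᵀ * Xh))
    (Ωu : (Fin p → ℝ) → ℝ) (hΩu : IsNorm Ωu)
    (lamNw : ℝ) (hlam : 0 < lamNw)
    (γhat : Fin p → ℝ) (hγhatV : γhat j = 0)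
    (hopt : ∀ γ : Fin p → ℝ, γ j = 0 →
      (∑ i, (Xh i j - Xh.mulVec γhat i) ^ 2) / (n : ℝ) + 2 * lamNw * Ωu γhat ≤
        (∑ i, (Xh i j - Xh.mulVec γ i) ^ 2) / (n : ℝ) + 2 * lamNw * Ωu γ)
    (τ2 : ℝ) (hτ2 : τ2 = (∑ i, Xh i j * (Xh i j - Xh.mulVec γhat i)) / (n : ℝ))
    (hτpos : 0 < τ2)
    (Θj : Fin p → ℝ) (hΘj : Θj = τ2⁻¹ • ((Pi.single j 1 : Fin p → ℝ) - γhat)) :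
    (Shat.mulVec Θj) j = 1 ∧
    ∀ v : Fin p → ℝ, v j = 0 →
      |∑ k, v k * (Shat.mulVec Θj - (Pi.single j 1 : Fin p → ℝ)) k| ≤
        (lamNw / τ2) * Ωu v := by
  obtain ⟨h0, h1, h2, h3⟩ := hΩu
  have hn' : (0:ℝ) < n := by exact_mod_cast hn
  set r : Fin n → ℝ := fun i => Xh i j - Xh.mulVec γhat i with hr
  have key : ∀ v : Fin p → ℝ, v j = 0 →
      (∑ i, r i * Xh.mulVec v i) / (n:ℝ) ≤ lamNw * Ωu v := by
    intro v hv
    set d : ℝ := (∑ i, (Xh.mulVec v i) ^ 2) / (n:ℝ) with hd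
    set c : ℝ := (∑ i, r i * Xh.mulVec v i) / (n:ℝ) with hc
    have hd0 : 0 ≤ d := by positivity
    have ht : ∀ t : ℝ, 0 < t → 2 * c ≤ 2 * lamNw * Ωu v + t * d := by
      intro t ht
      have h := hopt (γhat + t • v) (by simp [hγhatV, hv])
      have e : (∑ i, (Xh i j - Xh.mulVec (γhat + t • v) i) ^ 2) / (n:ℝ)
          = (∑ i, (Xh i j - Xh.mulVec γhat i) ^ 2) / (n:ℝ) - 2 * t * c + t ^ 2 * d := by
        have : ∑ i, (Xh i j - Xh.mulVec (γhat + t • v) i) ^ 2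
          = ∑ i, (Xh i j - Xh.mulVec γhat i) ^ 2 - 2 * t * (∑ i, r i * Xh.mulVec v i)
            + t ^ 2 * ∑ i, (Xh.mulVec v i) ^ 2 := by
          rw [Finset.mul_sum, Finset.mul_sum, ← Finset.sum_sub_distrib, ← Finset.sum_add_distrib]
          refine Finset.sum_congr rfl fun i _ => ?_
          rw [Matrix.mulVec_add, Matrix.mulVec_smul]
          simp only [Pi.add_apply, Pi.smul_apply, smul_eq_mul, hr]
          ring
        rw [this, hc, hd]
        ring
      rw [e] at h
      have h4 := h3 γhat (t • v)
      rw [h2, abs_of_pos ht] at h4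
      have h5 := mul_le_mul_of_nonneg_left h4 hlam.le
      have h6 : t * (2 * c) ≤ t * (2 * lamNw * Ωu v + t * d) := by nlinarith
      exact le_of_mul_le_mul_left h6 ht
    by_contra hcon
    push Not at hcon
    have hpos : 0 < (c - lamNw * Ωu v) / (d + 1) := by
      apply div_pos <;> linarith
    have h := ht _ hpos
    have h7 : (c - lamNw * Ωu v) / (d + 1) * d ≤ c - lamNw * Ωu v := by
      rw [div_mul_eq_mul_div, div_le_iff₀ (by linarith)]
      nlinarith
    linarith
  have hS : ∀ k, (Shat.mulVec Θj) k = τ2⁻¹ * ((∑ i, Xh i k * r i) / (n:ℝ)) := by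
    intro k
    have : Xh.mulVec ((Pi.single j 1 : Fin p → ℝ) - γhat) = r := by
      ext i
      simp [Matrix.mulVec_sub, hr]
    rw [hShat, hΘj, Matrix.mulVec_smul, Matrix.smul_mulVec, ← Matrix.mulVec_mulVec, this]
    simp only [Pi.smul_apply, smul_eq_mul, Matrix.mulVec, dotProduct, Matrix.transpose_apply]
    ring
  refine ⟨?_, ?_⟩
  · rw [hS, ← hτ2]
    exact inv_mul_cancel₀ hτpos.ne'
  · intro v hv
    have e : ∑ k, v k * (Shat.mulVec Θj - (Pi.single j 1 : Fin p → ℝ)) k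
        = τ2⁻¹ * ((∑ i, r i * Xh.mulVec v i) / (n:ℝ)) := by
      have e1 : ∀ k, v k * (Shat.mulVec Θj - (Pi.single j 1 : Fin p → ℝ)) k
          = τ2⁻¹ * ((∑ i, r i * (Xh i k * v k)) / (n:ℝ)) := by
        intro k
        have e2 : v k * (Pi.single j 1 : Fin p → ℝ) k = 0 := by
          by_cases hk : k = j
          · subst hk; simp [hv]
          · simp [hk]
        rw [Pi.sub_apply, mul_sub, e2, hS, sub_zero]
        have e3 : ∑ i, r i * (Xh i k * v k) = v k * ∑ i, Xh i k * r i := by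
          rw [Finset.mul_sum]
          exact Finset.sum_congr rfl fun i _ => by ring
        rw [e3]
        ring
      simp_rw [e1]
      rw [← Finset.mul_sum, ← Finset.sum_div, Finset.sum_comm]
      simp only [Matrix.mulVec, dotProduct, Finset.mul_sum]
    have k1 := key v hv
    have k2 := key (-v) (by simp [hv])
    have k3 : Ωu (-v) = Ωu v := by
      have := h2 (-1) v
      simpa using this
    rw [k3, Matrix.mulVec_neg] at k2
    simp only [Pi.neg_apply, mul_neg, Finset.sum_neg_distrib, neg_div] at k2
    rw [e, abs_mul, abs_of_pos (inv_pos.mpr hτpos), div_mul_eq_mul_div, div_eq_inv_mul (lamNw * _)]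
    exact mul_le_mul_of_nonneg_left (abs_le.mpr ⟨by linarith, k1⟩) (inv_pos.mpr hτpos).le
end
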